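/- For every α ∈ (0,1) there exists a constant C > 0, depending only on α, such that for every T > 0, every complex Banach space X, and every f ∈ C¹([0,T];X) with f(0) = 0, one has sup_{t∈[0,T]} ‖(I^{1−α} f′)(t)‖ ≤ C ( sup_{t∈[0,T]} ‖f(t)‖ )^{1−α} ( sup_{t∈[0,T]} ‖f′(t)‖ )^{α}. (This is the moment inequality ‖B^α f‖ ≤ C ‖f‖^{1−α} ‖Bf‖^{α} for the time-derivative operator B with zero initial condition, since B^α f = I^{1−α} f′ for f in the domain of B.) -/

import Mathlib

open MeasureTheory Set Real

universe u

/-- The Riemann–Liouville fractional integral of order `α` of `f : ℝ → X`. -/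
noncomputable def RL {X : Type u} [NormedAddCommGroup X] [NormedSpace ℂ X]
    (α : ℝ) (f : ℝ → X) (t : ℝ) : X :=
  (Real.Gamma α)⁻¹ • ∫ s in (0:ℝ)..t, ((t - s) ^ (α - 1) : ℝ) • f s

lemma mi_near {E : Type*} [NormedAddCommGroup E] [NormedSpace ℝ E]
    {α : ℝ} (hα : α ∈ Ioo (0:ℝ) 1) {a t M : ℝ} (hat : a ≤ t) {g : ℝ → E}
    (hg : ∀ s ∈ Icc a t, ‖g s‖ ≤ M) :
    ‖∫ s in a..t, ((t - s) ^ (1 - α - 1) : ℝ) • g s‖ ≤ M * (t - a) ^ (1 - α) / (1 - α) := by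
  obtain ⟨h0, h1⟩ := hα
  have hint : IntervalIntegrable (fun s : ℝ => (t - s) ^ (1 - α - 1)) volume a t := by
    have := (intervalIntegral.intervalIntegrable_rpow' (a := t - a) (b := 0)
      (r := 1 - α - 1) (by linarith)).comp_sub_left t
    simpa using this
  have := intervalIntegral.norm_integral_le_of_norm_le (μ := volume)
    (f := fun s => ((t - s) ^ (1 - α - 1) : ℝ) • g s)
    (g := fun s => M * (t - s) ^ (1 - α - 1)) hat ?_ (hint.const_mul M)
  · refine this.trans (le_of_eq ?_)
    rw [intervalIntegral.integral_const_mul,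
      intervalIntegral.integral_comp_sub_left (fun x : ℝ => x ^ (1 - α - 1)) t,
      integral_rpow (Or.inl (by linarith)), sub_self, sub_add_cancel,
      Real.zero_rpow (by linarith)]
    ring
  · refine Filter.Eventually.of_forall fun s hs => ?_
    rw [norm_smul, Real.norm_of_nonneg (Real.rpow_nonneg (by linarith [hs.2]) _), mul_comm]
    exact mul_le_mul_of_nonneg_right (hg s ⟨hs.1.le, hs.2⟩)
      (Real.rpow_nonneg (by linarith [hs.2]) _)

lemma mi_far {E : Type*} [NormedAddCommGroup E] [NormedSpace ℝ E] [CompleteSpace E]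
    {α : ℝ} (hα : α ∈ Ioo (0:ℝ) 1) {b t M : ℝ} (hb : 0 ≤ b) (hbt : b < t) {f f' : ℝ → E}
    (hf0 : f 0 = 0) (hd : ∀ s ∈ Icc 0 b, HasDerivWithinAt f (f' s) (Icc 0 b) s)
    (hc : ContinuousOn f' (Icc 0 b))
    (hM : ∀ s ∈ Icc 0 b, ‖f s‖ ≤ M) :
    ‖∫ s in (0:ℝ)..b, ((t - s) ^ (1 - α - 1) : ℝ) • f' s‖ ≤ 2 * M * (t - b) ^ (- α) := by
  obtain ⟨h0, h1⟩ := hα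
  have e : (1 - α - 1) = -α := by ring
  rw [e]
  have hM0 : 0 ≤ M := (norm_nonneg _).trans (hM 0 ⟨le_rfl, hb⟩)
  have hu : ∀ s ∈ (uIcc 0 b), HasDerivAt (fun s : ℝ => (t - s) ^ (-α)) (α * (t - s) ^ (-α - 1)) s := by
    intro s hs
    rw [uIcc_of_le hb] at hs
    have := ((hasDerivAt_id s).const_sub t).rpow_const (p := -α)
      (Or.inl (by simp; linarith [hs.2]))
    simpa using this
  have hcu : ContinuousOn (fun s : ℝ => α * (t - s) ^ (-α - 1)) (uIcc 0 b) := by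
    rw [uIcc_of_le hb]
    refine continuousOn_const.mul ((continuousOn_const.sub continuousOn_id).rpow_const ?_)
    intro s hs
    exact Or.inl (by simp; linarith [hs.2])
  have hu'i := hcu.intervalIntegrable (μ := volume)
  have hparts := intervalIntegral.integral_smul_deriv_eq_deriv_smul_of_hasDerivWithinAt
    (a := 0) (b := b) (u := fun s : ℝ => (t - s) ^ (-α)) (v := f) (v' := f')
    (fun s hs => (hu s hs).hasDerivWithinAt) (by rwa [uIcc_of_le hb]) hu'i
    (ContinuousOn.intervalIntegrable (by rwa [uIcc_of_le hb]))
  rw [hparts, hf0, smul_zero, sub_zero]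
  have hftc := intervalIntegral.integral_eq_sub_of_hasDerivAt hu hu'i
  have hI := intervalIntegral.norm_integral_le_of_norm_le (μ := volume)
    (f := fun s => (α * (t - s) ^ (-α - 1)) • f s)
    (g := fun s => M * (α * (t - s) ^ (-α - 1))) hb ?_ (hu'i.const_mul M)
  · rw [intervalIntegral.integral_const_mul, hftc] at hI
    refine (norm_sub_le _ _).trans ((add_le_add_right hI _).trans ?_)
    rw [norm_smul, Real.norm_of_nonneg (Real.rpow_nonneg (by linarith) _)]
    have h2 := mul_le_mul_of_nonneg_left (hM b ⟨hb, le_rfl⟩)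
      (Real.rpow_nonneg (by linarith : 0 ≤ t - b) (-α))
    have h3 := mul_nonneg hM0 (Real.rpow_nonneg (by linarith : 0 ≤ t - 0) (-α))
    nlinarith
  · refine Filter.Eventually.of_forall fun s hs => ?_
    have hn : 0 ≤ α * (t - s) ^ (-α - 1) :=
      mul_nonneg h0.le (Real.rpow_nonneg (by linarith [hs.2]) _)
    rw [norm_smul, Real.norm_of_nonneg hn, mul_comm]
    exact mul_le_mul_of_nonneg_right (hM s ⟨hs.1.le, hs.2⟩) hn

lemma mi_pos {E : Type*} [NormedAddCommGroup E] [NormedSpace ℝ E] [CompleteSpace E]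
    {α : ℝ} (hα : α ∈ Ioo (0:ℝ) 1) {t M₀ M₁ : ℝ} (ht : 0 ≤ t) {f f' : ℝ → E}
    (hf0 : f 0 = 0) (hd : ∀ s ∈ Icc 0 t, HasDerivWithinAt f (f' s) (Icc 0 t) s)
    (hc : ContinuousOn f' (Icc 0 t)) (p0 : 0 < M₀) (p1 : 0 < M₁)
    (hM0 : ∀ s ∈ Icc 0 t, ‖f s‖ ≤ M₀) (hM1 : ∀ s ∈ Icc 0 t, ‖f' s‖ ≤ M₁) :
    ‖∫ s in (0:ℝ)..t, ((t - s) ^ (1 - α - 1) : ℝ) • f' s‖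
      ≤ (2 + 1 / (1 - α)) * (M₀ ^ (1 - α) * M₁ ^ α) := by
  have h0 := hα.1
  have h1 : 0 < 1 - α := by linarith [hα.2]
  have key1 : M₁ * (M₀ / M₁) ^ (1 - α) = M₀ ^ (1 - α) * M₁ ^ α := by
    rw [Real.div_rpow p0.le p1.le, Real.rpow_sub p1, Real.rpow_one]
    have := (Real.rpow_pos_of_pos p1 α).ne'
    field_simp
  have key2 : M₀ * (M₀ / M₁) ^ (-α) = M₀ ^ (1 - α) * M₁ ^ α := by
    rw [Real.div_rpow p0.le p1.le, Real.rpow_sub p0, Real.rpow_one, Real.rpow_neg p0.le,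
      Real.rpow_neg p1.le]
    have := (Real.rpow_pos_of_pos p1 α).ne'
    field_simp
  have hP : 0 ≤ M₀ ^ (1 - α) * M₁ ^ α := by positivity
  rcases le_or_gt t (M₀ / M₁) with hcase | hcase
  · refine (mi_near hα ht hM1).trans ?_
    have : (t - 0) ^ (1 - α) ≤ (M₀ / M₁) ^ (1 - α) :=
      Real.rpow_le_rpow (by linarith) (by linarith) h1.le
    have h2 := mul_le_mul_of_nonneg_left this p1.le
    rw [key1] at h2
    have h3 := div_le_div_of_nonneg_right h2 h1.le
    refine h3.trans ?_
    rw [div_eq_mul_one_div]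
    nlinarith
  · have hh : 0 < M₀ / M₁ := by positivity
    set b := t - M₀ / M₁ with hb
    have hb0 : 0 ≤ b := by linarith
    have hbt : b < t := by linarith
    have hsub : Icc 0 b ⊆ Icc 0 t := Icc_subset_Icc_right hbt.le
    have hsub2 : Icc b t ⊆ Icc 0 t := Icc_subset_Icc_left hb0
    have hint : IntervalIntegrable (fun s : ℝ => (t - s) ^ (1 - α - 1)) volume 0 t := by
      have := (intervalIntegral.intervalIntegrable_rpow' (a := t - 0) (b := 0)
        (r := 1 - α - 1) (by linarith)).comp_sub_left t
      simpa using this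
    have hint2 : IntervalIntegrable (fun s : ℝ => (t - s) ^ (1 - α - 1) • f' s) volume 0 t :=
      hint.smul_continuousOn (by rwa [uIcc_of_le ht])
    have hfar := mi_far hα hb0 hbt hf0 (fun s hs => (hd s (hsub hs)).mono hsub)
      (hc.mono hsub) (fun s hs => hM0 s (hsub hs))
    have hnear := mi_near hα hbt.le (fun s hs => hM1 s (hsub2 hs))
    have e : t - b = M₀ / M₁ := by rw [hb]; ring
    rw [e, mul_assoc, key2] at hfar
    rw [e, key1] at hnear
    rw [← intervalIntegral.integral_add_adjacent_intervals (b := b)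
      (hint2.mono_set (by rw [uIcc_of_le hb0, uIcc_of_le ht]; exact hsub))
      (hint2.mono_set (by rw [uIcc_of_le hbt.le, uIcc_of_le ht]; exact hsub2))]
    refine (norm_add_le _ _).trans ((add_le_add hfar hnear).trans (le_of_eq ?_))
    ring

/-- The moment inequality `‖B^α f‖ ≤ C ‖f‖^{1−α} ‖Bf‖^{α}` for the time-derivative
operator `B` with zero initial condition: for every `α ∈ (0,1)` there is `C > 0`,
depending only on `α`, such that for every `T > 0`, every complex Banach space `X` and
every `f ∈ C¹([0,T];X)` with `f(0) = 0` (with derivative `f′`),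
`sup ‖(I^{1−α} f′)(t)‖ ≤ C (sup ‖f‖)^{1−α} (sup ‖f′‖)^{α}`
(note `B^α f = I^{1−α} f′` for `f` in the domain of `B`). -/
theorem moment_inequality
    (α : ℝ) (hα : α ∈ Ioo (0:ℝ) 1) :
    ∃ C > (0:ℝ), ∀ (T : ℝ), 0 < T →
      ∀ (X : Type u) [NormedAddCommGroup X] [NormedSpace ℂ X] [CompleteSpace X],
      ∀ f f' : ℝ → X, f 0 = 0 →
        (∀ t ∈ Icc (0:ℝ) T, HasDerivWithinAt f (f' t) (Icc 0 T) t) →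
        ContinuousOn f' (Icc 0 T) →
        ∀ M₀ M₁ : ℝ, (∀ t ∈ Icc (0:ℝ) T, ‖f t‖ ≤ M₀) → (∀ t ∈ Icc (0:ℝ) T, ‖f' t‖ ≤ M₁) →
          ∀ t ∈ Icc (0:ℝ) T, ‖RL (1 - α) f' t‖ ≤ C * M₀ ^ (1 - α) * M₁ ^ α := by
  have h1 : 0 < 1 - α := by linarith [hα.2]
  have hG : 0 < Real.Gamma (1 - α) := Real.Gamma_pos_of_pos h1
  refine ⟨(Real.Gamma (1 - α))⁻¹ * (2 + 1 / (1 - α)), by positivity, ?_⟩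
  intro T hT X _ _ _ f f' hf0 hd hc M₀ M₁ hM0 hM1 t ht
  have hsub : Icc 0 t ⊆ Icc 0 T := Icc_subset_Icc_right ht.2
  have n0 : 0 ≤ M₀ := (norm_nonneg _).trans (hM0 t ht)
  have n1 : 0 ≤ M₁ := (norm_nonneg _).trans (hM1 t ht)
  have key : ∀ ε > (0:ℝ), ‖RL (1 - α) f' t‖ ≤
      (Real.Gamma (1 - α))⁻¹ * (2 + 1 / (1 - α)) * (M₀ + ε) ^ (1 - α) * (M₁ + ε) ^ α := by
    intro ε hε
    have := mi_pos hα ht.1 hf0 (fun s hs => (hd s (hsub hs)).mono hsub) (hc.mono hsub)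
      (M₀ := M₀ + ε) (M₁ := M₁ + ε) (by linarith) (by linarith)
      (fun s hs => (hM0 s (hsub hs)).trans (by linarith))
      (fun s hs => (hM1 s (hsub hs)).trans (by linarith))
    unfold RL
    rw [norm_smul, Real.norm_of_nonneg (inv_nonneg.2 hG.le), mul_assoc, mul_assoc]
    exact mul_le_mul_of_nonneg_left this (inv_nonneg.2 hG.le)
  have hcont : Continuous (fun ε : ℝ => (Real.Gamma (1 - α))⁻¹ * (2 + 1 / (1 - α)) *
      (M₀ + ε) ^ (1 - α) * (M₁ + ε) ^ α) := by
    refine Continuous.mul (continuous_const.mul ?_) ?_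
    · exact (continuous_const.add continuous_id).rpow_const fun _ => Or.inr h1.le
    · exact (continuous_const.add continuous_id).rpow_const fun _ => Or.inr hα.1.le
  have hlim := (hcont.tendsto 0).mono_left (nhdsWithin_le_nhds (s := Ioi 0))
  simp only [add_zero] at hlim
  exact ge_of_tendsto hlim (by filter_upwards [self_mem_nhdsWithin] with ε hε using key ε hε)
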